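/- arXiv:2010.03664 — 8 statements merged into one kernel-verified Lean document; each statement's English description precedes it below -/
import Mathlib

section
/- Let M be a model of Flow, i.e., a type with an evaluation operation ev : M → M → M (writing f(x) for ev f x) satisfying Axioms F1 and F2. Then for all f, g in M: f = g if and only if f(x) = g(x) for every x in M. -/
/-- Axiom F1 (Weak Extensionality). -/
def FlowF1 (M : Type*) (ev : M → M → M) : Prop :=
  ∀ f g : M, ((ev f g = f ∧ ev g f = g) ∨ (ev f g = g ∧ ev g f = f)) → f = g

/-- Axiom F2 (Self-Reference). -/
def FlowF2 (M : Type*) (ev : M → M → M) : Prop :=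
  ∀ f : M, ev f f = f

/-- `z` is a rigid function. -/
def IsRigid (M : Type*) (ev : M → M → M) (z : M) : Prop :=
  ∀ x, ev z x = z

/-- `o` is an identity function. -/
def IsIdentity (M : Type*) (ev : M → M → M) (o : M) : Prop :=
  ∀ x, ev o x = x

/-- `h` is an F-composition of `f` and `g` (relative to rigid `z` and identity `o`). -/
def IsFComp (M : Type*) (ev : M → M → M) (z o f g h : M) : Prop :=
  h ≠ z ∧
  (∀ x, x ≠ f → x ≠ g → x ≠ h → ev h x = ev f (ev g x)) ∧
  (h ≠ f → ev h f = z) ∧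
  (h ≠ g → ev h g = z) ∧
  ((g ≠ h ∧ f ≠ h ∧ g ≠ o ∧ f ≠ o) → (ev f (ev g h) = z ∨ ev g h = z))

/-- Axiom F5 (F-Composition): unique F-composition exists for all pairs. -/
def FlowF5 (M : Type*) (ev : M → M → M) (z o : M) : Prop :=
  ∀ f g : M, ∃! h : M, IsFComp M ev z o f g h

/-- `f` acts on `t` (written `f[t]`). -/
def Acts (M : Type*) (ev : M → M → M) (z f t : M) : Prop :=
  t ≠ f ∧ ev f t ≠ z

theorem stmt0 {M : Type*} (ev : M → M → M)
    (hF1 : FlowF1 M ev) (hF2 : FlowF2 M ev) :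
    ∀ f g : M, f = g ↔ ∀ x, ev f x = ev g x := by
  intro f g
  refine ⟨fun h _ => h ▸ rfl, fun h => hF1 f g (Or.inr ⟨?_, ?_⟩)⟩
  · rw [h g, hF2 g]
  · rw [← h f, hF2 f]
end

section
/- Let M be a model of Flow satisfying Axioms F1, F2 and F5, with rigid function 0 and identity function 1. Then there exists a unique h in M such that h ≠ 0 and h(x) = 0 for every x ≠ h. (This element is denoted φ0 and equals 0 ∘ 0.) -/
/-- The F-compositions of a rigid function with itself are the nonzero functions that vanish at
every other argument. -/
theorem isFComp_rigid_self_iff {M : Type*} {ev : M → M → M} {z : M} (o : M)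
    (hz : IsRigid M ev z) (h : M) :
    IsFComp M ev z o z z h ↔ h ≠ z ∧ ∀ x, x ≠ h → ev h x = z := by
  constructor
  · rintro ⟨h_ne, h_comp, h_zero, -, -⟩
    refine ⟨h_ne, fun x hx => ?_⟩
    by_cases hxz : x = z
    · exact hxz ▸ h_zero h_ne
    · rw [h_comp x hxz hxz hx, hz]
  · rintro ⟨h_ne, h_vanish⟩
    refine ⟨h_ne, fun x _ _ hx => ?_, fun _ => h_vanish z h_ne.symm,
      fun _ => h_vanish z h_ne.symm, fun _ => Or.inl (hz _)⟩
    rw [h_vanish x hx, hz]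

theorem stmt6 {M : Type*} (ev : M → M → M) (z o : M)
    (hF1 : FlowF1 M ev) (hF2 : FlowF2 M ev)
    (hz : IsRigid M ev z) (ho : IsIdentity M ev o)
    (hF5 : FlowF5 M ev z o) :
    ∃! h : M, h ≠ z ∧ ∀ x, x ≠ h → ev h x = z := by
  simpa only [isFComp_rigid_self_iff o hz] using hF5 z z
end

section
/- Let M be a model of Flow satisfying Axioms F1, F2 and F5, with rigid function 0 and identity function 1, and write f ∘ g for the unique F-composition of f and g; let φ0 = 0 ∘ 0. Then for every x in M, 0 ∘ x = φ0 and x ∘ 0 = φ0. -/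
/-- Composing an element that moves `z` with the identity yields one that also sends `o` to `z`. -/
theorem IsFComp.exists_normalized {M : Type*} {ev : M → M → M} {z o : M}
    (hz : IsRigid M ev z) (ho : IsIdentity M ev o)
    {comp : M → M → M} (hcomp : ∀ f g : M, IsFComp M ev z o f g (comp f g))
    {a : M} (ha : ev a z ≠ z) : ∃ k, ev k z = ev a z ∧ ev k o = z := by
  obtain ⟨h0, h1, h2, h3, h4⟩ := hcomp a o
  have hza : z ≠ a := fun h => ha (h ▸ hz z)
  have hzo : z ≠ o := fun h => h0 (by rw [← ho (comp a o), ← h, hz])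
  have hk : ev (comp a o) z = ev a z := by rw [h1 z hza hzo h0.symm, ho]
  exact ⟨_, hk, h3 fun h => ha (by rw [← hk, h, ho])⟩

theorem IsFComp.ev_zero {M : Type*} {ev : M → M → M} {z o : M}
    (hF1 : FlowF1 M ev) (hF2 : FlowF2 M ev)
    (hz : IsRigid M ev z) (ho : IsIdentity M ev o)
    {comp : M → M → M} (hcomp : ∀ f g : M, IsFComp M ev z o f g (comp f g))
    (x : M) : ev x z = z := by
  by_contra hx
  obtain ⟨a, haz, hao⟩ := IsFComp.exists_normalized hz ho hcomp hx
  rw [← haz] at hx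
  clear haz
  obtain ⟨b, hb⟩ : ∃ b, ev a z = b := ⟨_, rfl⟩
  have hbz : b ≠ z := hb ▸ hx
  have hza : a ≠ z := fun h => hx (h ▸ hz z)
  have hba : b ≠ a := fun h => hza (hF1 a z (Or.inl ⟨hb.trans h, hz a⟩))
  obtain ⟨p, hp⟩ : ∃ p, comp z z = p := ⟨_, rfl⟩
  obtain ⟨hpz, hp1, hp2, -, -⟩ := hp ▸ hcomp z z
  have hoz : o ≠ z := fun h => hpz (by rw [← ho p, h, hz])
  have hpv : ∀ y, y ≠ p → ev p y = z := by
    intro y hy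
    by_cases h : y = z
    · exact h ▸ hp2 hpz
    · rw [hp1 y h h hy, hz]
  have hpa : p ≠ a := fun h => hx (h ▸ hpv z hpz.symm)
  have hoa : o ≠ a := fun h => hx (h ▸ ho z)
  have hop : o ≠ p := by
    intro h
    have h1 := hpv a hpa.symm
    rw [← h, ho] at h1
    exact hza h1
  obtain ⟨d, hd⟩ : ∃ d, comp a p = d := ⟨_, rfl⟩
  obtain ⟨hdz, hd1, hd2, hd3, -⟩ := hd ▸ hcomp a p
  have hdv : ∀ y, y ≠ a → y ≠ p → y ≠ d → ev d y = b := by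
    intro y h1 h2 h3
    rw [hd1 y h1 h2 h3, hpv y h2, hb]
  have hdp : d ≠ p := by
    intro h
    have := hdv z hza.symm hpz.symm hdz.symm
    rw [h, hpv z hpz.symm] at this
    exact hbz this.symm
  have hod : o ≠ d := by
    intro h
    have := hdv z hza.symm hpz.symm hdz.symm
    rw [← h, ho] at this
    exact hbz this.symm
  have hda : d ≠ a := by
    intro h
    have := hdv o hoa hop hod
    rw [h, hao] at this
    exact hbz this.symm
  have hdza := hd2 hda
  have hdzp := hd3 hdp
  have hdzz := hdv z hza.symm hpz.symm hdz.symm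
  have hpzz := hpv z hpz.symm
  have hdo := hdv o hoa hop hod
  obtain ⟨q, hq⟩ : ∃ q, comp d d = q := ⟨_, rfl⟩
  obtain ⟨hqz, hq1, hq2, -, hq4⟩ := hq ▸ hcomp d d
  have hqd : q ≠ d := by
    intro h
    have := hq1 p hdp.symm hdp.symm (h ▸ hdp.symm)
    rw [h, hdzp, hdzz] at this
    exact hbz this.symm
  have hdd := hF2 d
  by_cases hbp : b = p
  · subst hbp
    have hqb : q ≠ b := by grind
    have hqa : q ≠ a := by grind
    have hqzz : ev q z = z := by grind
    have hod' := ho d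
    have hoq : o ≠ q := by grind
    have hqo : ev q o = z := by grind
    have hqv : ev q b = b := by grind
    obtain ⟨r, hr⟩ : ∃ r, comp q d = r := ⟨_, rfl⟩
    obtain ⟨hrz, hr1, hr2, hr3, hr4⟩ := hr ▸ hcomp q d
    have hrzz : ev r z = b := by grind
    have hoz' := ho z
    have hro : r ≠ o := by grind
    have hrb : r ≠ b := by grind
    have hrq : r ≠ q := by grind
    have hra : r ≠ a := by grind
    have hrd : r ≠ d := by grind
    grind
  · have hbd : b ≠ d := by
      intro h
      exact hdz (hF1 d z (Or.inl ⟨hdzz.trans h, hz d⟩))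
    have hdb := hdv b hba hbp hbd
    have hqp : q ≠ p := by grind
    have hqa : q ≠ a := by grind
    grind

theorem stmt9 {M : Type*} (ev : M → M → M) (z o : M)
    (hF1 : FlowF1 M ev) (hF2 : FlowF2 M ev)
    (hz : IsRigid M ev z) (ho : IsIdentity M ev o)
    (hF5 : FlowF5 M ev z o)
    (comp : M → M → M)
    (hcomp : ∀ f g : M, IsFComp M ev z o f g (comp f g)) :
    ∀ x : M, comp z x = comp z z ∧ comp x z = comp z z := by
  have ev_zero := IsFComp.ev_zero hF1 hF2 hz ho hcomp
  have key : ∀ h, h ≠ z → (∀ y, y ≠ h → ev h y = z) → h = comp z z := by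
    intro h h0 hv
    refine (hF5 z z).unique ⟨h0, ?_, ?_, ?_, ?_⟩ (hcomp z z)
    · intro y _ _ hy
      rw [hv y hy, hz]
    · exact fun hh => hv z hh.symm
    · exact fun hh => hv z hh.symm
    · exact fun _ => Or.inl (hz _)
  intro x
  constructor
  · obtain ⟨h0, h1, h2, h3, -⟩ := hcomp z x
    refine key _ h0 fun y hy => ?_
    by_cases hyz : y = z
    · rw [hyz, ev_zero]
    by_cases hyx : y = x
    · exact hyx ▸ h3 (hyx ▸ hy.symm)
    · rw [h1 y hyz hyx hy, hz]
  · obtain ⟨h0, h1, h2, h3, -⟩ := hcomp x z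
    refine key _ h0 fun y hy => ?_
    by_cases hyz : y = z
    · rw [hyz, ev_zero]
    by_cases hyx : y = x
    · exact hyx ▸ h2 (hyx ▸ hy.symm)
    · rw [h1 y hyx hyz hy, hz, ev_zero]
end

section
/- Let M be a model of Flow satisfying Axioms F1, F2 and F5, with rigid function 0 and identity function 1. Then for every x in M, x(0) = 0. -/
theorem zero_ne_one_of_eval_zero_ne {M : Type*} {ev : M → M → M} {z o : M} {x : M}
    (hz : IsRigid M ev z) (ho : IsIdentity M ev o) (hx : ev x z ≠ z) : z ≠ o := by
  intro h
  have h1 := hz (ev x z)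
  have h2 := ho (ev x z)
  rw [← h] at h2
  exact hx (h2.symm.trans h1)

/-- Composing `x` with `0`, when `x(0) ≠ 0`. -/
theorem exists_comp_zero {M : Type*} {ev : M → M → M} {z o : M} {x : M}
    (hz : IsRigid M ev z) (ho : IsIdentity M ev o) (hF5 : FlowF5 M ev z o)
    (hx : ev x z ≠ z) :
    ∃ h, h ≠ z ∧ h ≠ x ∧ h ≠ o ∧ ev h z = z ∧ ev h x = z ∧
      ∀ y, y ≠ z → y ≠ x → y ≠ h → ev h y = ev x z := by
  obtain ⟨h, ⟨h1, h2, h3, h4, -⟩, -⟩ := hF5 x z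
  have hxz : x ≠ z := fun e => hx (e ▸ hz z)
  have hhx : h ≠ x := fun e => hx (e ▸ h4 h1)
  refine ⟨h, h1, hhx, ?_, h4 h1, h3 hhx, fun y hy hyx hyh => ?_⟩
  · rintro rfl
    exact hxz ((ho x).symm.trans (h3 hhx))
  · rw [h2 y hyx hy hyh, hz]

/-- A function `x` with `x(0) ≠ 0` is not its own value at `0`. -/
theorem eval_zero_ne_self {M : Type*} {ev : M → M → M} {z x : M}
    (hF1 : FlowF1 M ev) (hz : IsRigid M ev z) (hx : ev x z ≠ z) : ev x z ≠ x := by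
  intro e
  have hxz : x = z := hF1 x z (Or.inl ⟨e, hz x⟩)
  exact hx (hxz ▸ hz z)

/-- Composing `x` with `x ∘ 0`, when `x(0) ≠ 0`: either `x` vanishes at `x(0)` and there is a
function supported at `0` with the same value there, or `x` is constant off `0` and `x ∘ 0`. -/
theorem comp_comp_zero_dichotomy {M : Type*} {ev : M → M → M} {z o : M} {x h : M}
    (hz : IsRigid M ev z) (hF5 : FlowF5 M ev z o) (hx : ev x z ≠ z) (hxo : x ≠ o)
    (h1 : h ≠ z) (h2 : h ≠ x) (h3 : h ≠ o) (h4 : ev h z = z)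
    (h6 : ∀ y, y ≠ z → y ≠ x → y ≠ h → ev h y = ev x z) :
    (ev x (ev x z) = z ∧ ∃ l, ev l z = ev x z ∧ ∀ y, y ≠ z → y ≠ l → ev l y = z) ∨
      (ev x h = z ∧ ∀ y, y ≠ z → y ≠ x → y ≠ h → ev x y = ev x (ev x z)) := by
  obtain ⟨l, ⟨l1, l2, l3, l4, l5⟩, -⟩ := hF5 x h
  have hxz : x ≠ z := fun e => hx (e ▸ hz z)
  have hlz : ev l z = ev x z := by rw [l2 z hxz.symm h1.symm l1.symm, h4]
  have hlh : l ≠ h := fun e => hx (by rw [← hlz, e, h4])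
  by_cases hlx : l = x
  · subst hlx
    refine Or.inr ⟨l4 hlh, fun y hy hyl hyh => ?_⟩
    rw [l2 y hyl hyh hyl, h6 y hy hyl hyh]
  · have hl : ev h l = ev x z := h6 l l1 hlx hlh
    have hxa : ev x (ev x z) = z := by
      rcases l5 ⟨hlh.symm, Ne.symm hlx, h3, hxo⟩ with e | e
      · rwa [hl] at e
      · exact absurd (hl.symm.trans e) hx
    refine Or.inl ⟨hxa, l, hlz, fun y hy hyl => ?_⟩
    by_cases hyx : y = x
    · rw [hyx]; exact l3 hlx
    by_cases hyh : y = h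
    · rw [hyh]; exact l4 hlh
    rw [l2 y hyx hyh hyl, h6 y hy hyx hyh, hxa]

/-- If some function does not vanish at `0`, then one vanishes exactly off `0` and itself. -/
theorem exists_supported_at_zero {M : Type*} {ev : M → M → M} {z o : M} {x : M}
    (hz : IsRigid M ev z) (ho : IsIdentity M ev o) (hF5 : FlowF5 M ev z o) (hx : ev x z ≠ z) :
    ∃ l, ev l z ≠ z ∧ ∀ y, y ≠ z → y ≠ l → ev l y = z := by
  have hxz : x ≠ z := fun e => hx (e ▸ hz z)
  have hzo := zero_ne_one_of_eval_zero_ne hz ho hx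
  have hxo : x ≠ o := fun e => hx (e ▸ ho z)
  obtain ⟨w, ⟨w1, w2, w3, w4, -⟩, -⟩ := hF5 o x
  have hwz : ev w z = ev x z := by rw [w2 z hzo hxz.symm w1.symm, ho]
  have hw : ev w z ≠ z := hwz ▸ hx
  have hwo : w ≠ o := fun e => hw (e ▸ ho z)
  obtain ⟨h, h1, h2, h3, h4, -, h6⟩ := exists_comp_zero hz ho hF5 hw
  rcases comp_comp_zero_dichotomy hz hF5 hw hwo h1 h2 h3 h4 h6 with
    ⟨-, l, hl, hl'⟩ | ⟨hwh, hc⟩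
  · exact ⟨l, hl ▸ hw, hl'⟩
  · refine ⟨w, hw, fun y hy hyw => ?_⟩
    by_cases hyh : y = h
    · rw [hyh, hwh]
    · rw [hc y hy hyw hyh, ← hc o hzo.symm hwo.symm h3.symm, w3 hwo]

/-- Some nonzero function vanishes everywhere but at itself. -/
theorem exists_empty {M : Type*} {ev : M → M → M} {z o : M}
    (hz : IsRigid M ev z) (hF5 : FlowF5 M ev z o) :
    ∃ p, p ≠ z ∧ ∀ y, y ≠ p → ev p y = z := by
  obtain ⟨p, ⟨p1, p2, p3, -, -⟩, -⟩ := hF5 z z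
  refine ⟨p, p1, fun y hy => ?_⟩
  by_cases hyz : y = z
  · rw [hyz]; exact p3 p1
  · rw [p2 y hyz hyz hy, hz]

theorem stmt10 {M : Type*} (ev : M → M → M) (z o : M)
    (hF1 : FlowF1 M ev) (hF2 : FlowF2 M ev)
    (hz : IsRigid M ev z) (ho : IsIdentity M ev o)
    (hF5 : FlowF5 M ev z o) :
    ∀ x : M, ev x z = z := by
  intro x₀
  by_contra hx₀
  obtain ⟨x, hx, hx'⟩ := exists_supported_at_zero hz ho hF5 hx₀
  obtain ⟨p, hpz, hp⟩ := exists_empty hz hF5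
  have hzo := zero_ne_one_of_eval_zero_ne hz ho hx
  have hxz : x ≠ z := fun e => hx (e ▸ hz z)
  have hxo : x ≠ o := fun e => hx (e ▸ ho z)
  have hxp : x ≠ p := fun e => hx (e ▸ hp z hpz.symm)
  have hpo : p ≠ o := fun e => hxz (by rw [← ho x, ← e]; exact hp x hxp)
  have hax : ev x z ≠ x := eval_zero_ne_self hF1 hz hx
  obtain ⟨h, h1, h2, h3, h4, -, h6⟩ := exists_comp_zero hz ho hF5 hx
  have hho : ev h o = ev x z := h6 o hzo.symm hxo.symm h3.symm
  have hhp : h ≠ p := fun e => hx (by rw [← hho, e]; exact hp o hpo.symm)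
  -- `k = x ∘ p` vanishes at `x` and `p`, and is constantly `x(0)` elsewhere
  obtain ⟨k, ⟨k1, k2, k3, k4, -⟩, -⟩ := hF5 x p
  have hk : ∀ y, y ≠ x → y ≠ p → y ≠ k → ev k y = ev x z := fun y a b c => by
    rw [k2 y a b c, hp y b]
  have hkz : ev k z = ev x z := hk z hxz.symm hpz.symm k1.symm
  have hkz' : ev k z ≠ z := hkz ▸ hx
  have hko : k ≠ o := fun e => hkz' (e ▸ ho z)
  have hkp : k ≠ p := fun e => hkz' (e ▸ hp z hpz.symm)
  have hko' : ev k o = ev x z := hk o hxo.symm hpo.symm hko.symm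
  have hkx : k ≠ x := fun e => hx (by rw [← hko', e]; exact hx' o hzo.symm hxo.symm)
  have hka : ev k (ev x z) = z := by
    obtain ⟨g, g1, g2, g3, g4, -, g6⟩ := exists_comp_zero hz ho hF5 hkz'
    rcases comp_comp_zero_dichotomy hz hF5 hkz' hko g1 g2 g3 g4 g6 with
      ⟨e, -⟩ | ⟨-, hc⟩
    · rwa [hkz] at e
    · by_cases hgx : x = g
      · rw [← hkz, ← hc p hpz hkp.symm (fun e => hxp (hgx.trans e.symm)), k4 hkp]
      · rw [← hkz, ← hc x hxz hkx.symm hgx, k3 hkx]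
  have hap : ev x z = p := by
    by_contra hne
    by_cases hak : ev x z = k
    · rw [hak, hF2] at hka
      exact k1 hka
    · exact hx ((hk _ hax hne hak).symm.trans hka)
  have hhk : h ≠ k := fun e => hkz' (e ▸ h4)
  have hhp' : ev h p = p := (h6 p hpz hxp.symm hhp.symm).trans hap
  obtain ⟨r, ⟨r1, r2, r3, r4, r5⟩, -⟩ := hF5 h k
  have hrh : r ≠ h := fun e => hpz (by
    rw [← hhp', ← hap, ← hkz, ← r2 z h1.symm k1.symm r1.symm, e, h4])
  have hkh : ev k h = p := (hk h h2 hhp hhk).trans hap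
  have hrk : r ≠ k := fun e => hpz (by rw [← hkh, ← e]; exact r3 hrh)
  have hro : r ≠ o := fun e => h1 (by rw [← ho h, ← e]; exact r3 hrh)
  have hro' : ev r o = p := by rw [r2 o h3.symm hko.symm hro.symm, hko', hap, hhp']
  have hrx : r ≠ x := fun e => hpz (by rw [← hro', e]; exact hx' o hzo.symm hxo.symm)
  have hrp : r ≠ p := fun e => hpz (by
    have := hp o hpo.symm
    rwa [← e, hro'] at this)
  have hkr : ev k r = p := (hk r hrx hrp hrk).trans hap
  rcases r5 ⟨hrk.symm, hrh.symm, hko, h3⟩ with e | e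
  · rw [hkr, hhp'] at e
    exact hpz e
  · exact hpz (hkr.symm.trans e)
end

section
/- Let M be a model of Flow satisfying Axioms F1, F2 and F5, with rigid function 0 and identity function 1, and write f ∘ g for the unique F-composition of f and g. Then for every x in M: (x ≠ 0 and x(1) = 0) if and only if (1 ∘ x = x and x ∘ 1 = x and x ≠ 1). -/
theorem stmt13 {M : Type*} (ev : M → M → M) (z o : M)
    (hF1 : FlowF1 M ev) (hF2 : FlowF2 M ev)
    (hz : IsRigid M ev z) (ho : IsIdentity M ev o)
    (hF5 : FlowF5 M ev z o)
    (comp : M → M → M)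
    (hcomp : ∀ f g : M, IsFComp M ev z o f g (comp f g)) :
    ∀ x : M, (x ≠ z ∧ ev x o = z) ↔
      (comp o x = x ∧ comp x o = x ∧ x ≠ o) := by
  intro x
  constructor
  · rintro ⟨hxz, hxo⟩
    have hne : x ≠ o := by
      rintro rfl
      exact hxz ((hF2 x).symm.trans hxo)
    have left_comp : IsFComp M ev z o o x x :=
      ⟨hxz, fun y _ _ _ => (ho (ev x y)).symm, fun _ => hxo, fun h => absurd rfl h,
        fun h => absurd rfl h.1⟩
    have right_comp : IsFComp M ev z o x o x :=
      ⟨hxz, fun y _ _ _ => by rw [ho y], fun h => absurd rfl h, fun _ => hxo,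
        fun h => absurd rfl h.2.1⟩
    exact ⟨(hF5 o x).unique (hcomp o x) left_comp,
      (hF5 x o).unique (hcomp x o) right_comp, hne⟩
  · rintro ⟨hox, -, hne⟩
    have h := hcomp o x
    rw [hox] at h
    exact ⟨h.1, h.2.2.1 hne⟩
end

section
/- Let M be a model of Flow satisfying Axioms F1, F2 and F5, with rigid function 0 and identity function 1, and let φ0 = 0 ∘ 0. Then 0 and φ0 are the only functions which do not act on any term: for every f in M, (for all t, ¬f[t]) if and only if (f = 0 or f = φ0). -/
theorem stmt14 {M : Type*} (ev : M → M → M) (z o : M)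
    (hF1 : FlowF1 M ev) (hF2 : FlowF2 M ev)
    (hz : IsRigid M ev z) (ho : IsIdentity M ev o)
    (hF5 : FlowF5 M ev z o)
    (comp : M → M → M)
    (hcomp : ∀ f g : M, IsFComp M ev z o f g (comp f g)) :
    ∀ f : M, (∀ t, ¬ Acts M ev z f t) ↔ (f = z ∨ f = comp z z) := by
  intro f
  constructor
  · intro hf
    have hev : ∀ x, x ≠ f → ev f x = z := fun x hx => by
      by_contra hne
      exact hf x ⟨hx, hne⟩
    by_cases hfz : f = z
    · exact Or.inl hfz
    · have hcomp_f : IsFComp M ev z o z z f :=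
        ⟨hfz, fun x _ _ hx => (hev x hx).trans (hz _).symm,
          fun h => hev z h.symm, fun h => hev z h.symm, fun _ => Or.inl (hz _)⟩
      exact Or.inr ((hF5 z z).unique hcomp_f (hcomp z z))
  · rintro (rfl | rfl) t ⟨ht, hne⟩
    · exact hne (hz t)
    · obtain ⟨hz_ne, hev, hev_z, -, -⟩ := hcomp z z
      by_cases htz : t = z
      · exact hne (htz ▸ hev_z hz_ne)
      · exact hne ((hev t htz htz ht).trans (hz _))
end

section
/- Let M be a model of Flow satisfying Axioms F1, F2 and F5, with rigid function 0 and identity function 1. Then for every t ≠ 1 there is no x in M such that x(t) = 1 and x(1) = t. -/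
theorem stmt16 {M : Type*} (ev : M → M → M) (z o : M)
    (hF1 : FlowF1 M ev) (hF2 : FlowF2 M ev)
    (hz : IsRigid M ev z) (ho : IsIdentity M ev o)
    (hF5 : FlowF5 M ev z o) :
    ∀ t : M, t ≠ o → ¬ ∃ x : M, ev x t = o ∧ ev x o = t := by
  rintro t hto ⟨x, hxt, hxo⟩
  have hx_o : x ≠ o := by
    rintro rfl
    exact hto ((ho t).symm.trans hxt)
  have hx_t : x ≠ t := by
    rintro rfl
    exact hto ((hF2 x).symm.trans hxt)
  have hx_z : x ≠ z := by
    rintro rfl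
    exact hto (hxo.symm.trans ((hz o).trans ((hz t).symm.trans hxt)))
  obtain ⟨h, ⟨-, hcomp, hzero, -, -⟩, -⟩ := hF5 x x
  have hh_x : h ≠ x := by
    rintro rfl
    have := hcomp t hx_t.symm hx_t.symm hx_t.symm
    rw [hxt, hxo] at this
    exact hto this.symm
  have hh_o : h ≠ o := by
    rintro rfl
    exact hx_z ((ho x).symm.trans (hzero hh_x))
  have ho_fixed : ev h o = o := by
    rw [hcomp o hx_o.symm hx_o.symm hh_o.symm, hxo, hxt]
  exact hh_o (hF1 h o (Or.inr ⟨ho_fixed, ho h⟩))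
end

section
/- Let M be a model of Flow satisfying Axioms F1, F2 and F5, with rigid function 0 and identity function 1, and let s be an element of M implementing the F-successor function of Axiom F6 (writing σ_f for s(f)). Then s and 0 are the only functions f such that σ_f = f: for every f in M, σ_f = f if and only if (f = s or f = 0). -/
/-- Σ(f,g): `g` is an F-successor of `f`. -/
def FSucc (M : Type*) (ev : M → M → M) (z f g : M) : Prop :=
  ev f g = z ∧ ∀ x, x ≠ g → ev g x = ev f x

/-- `s` implements the F-successor function (Axiom F6). -/
def ImplementsF6 (M : Type*) (ev : M → M → M) (z s : M) : Prop :=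
  s ≠ z ∧ ∀ f, f ≠ s → f ≠ z →
    ((ev s f ≠ z → FSucc M ev z f (ev s f)) ∧
     (ev s f = z → ∀ h, ¬ FSucc M ev z f h))

theorem exists_vanishing_off_self {M : Type*} {ev : M → M → M} {z o : M}
    (hz : IsRigid M ev z) (hF5 : FlowF5 M ev z o) :
    ∃ e, e ≠ z ∧ ∀ x, x ≠ e → ev e x = z := by
  obtain ⟨e, ⟨he, hgen, hleft, -, -⟩, -⟩ := hF5 z z
  refine ⟨e, he, fun x hx => ?_⟩
  by_cases hxz : x = z
  · exact hxz ▸ hleft he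
  · rw [hgen x hxz hxz hx, hz]

/-- If `f` does not vanish at the rigid function, then its composition `p` with a function `e`
vanishing off itself is a zero of `f` other than `f`, and `f` has a further zero. -/
theorem zeros_of_apply_rigid_ne {M : Type*} {ev : M → M → M} {z o e f p : M}
    (hF1 : FlowF1 M ev) (hF2 : FlowF2 M ev) (hz : IsRigid M ev z) (ho : IsIdentity M ev o)
    (hF5 : FlowF5 M ev z o) (he : e ≠ z) (hez : ∀ x, x ≠ e → ev e x = z)
    (hf : ev f z ≠ z) (hp : IsFComp M ev z o f e p) :
    p ≠ e ∧ p ≠ f ∧ ev p z = ev f z ∧ ev f p = z ∧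
      ∃ k, k ≠ p ∧ k ≠ e ∧ k ≠ f ∧ ev f k = z := by
  have hfz : f ≠ z := fun h => hf (h ▸ hz _)
  have hee : ev e z = z := hez z he.symm
  have hfe : f ≠ e := fun h => hf (h ▸ hee)
  obtain ⟨hpz, hpgen, hpf, hpe, -⟩ := hp
  have hpconst : ∀ x, x ≠ f → x ≠ e → x ≠ p → ev p x = ev f z := fun x h1 h2 h3 => by
    rw [hpgen x h1 h2 h3, hez x h2]
  have hp0 : ev p z = ev f z := hpconst z hfz.symm he.symm hpz.symm
  have hpe' : p ≠ e := fun h => hf (by rw [← hp0, h, hee])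
  have haf : ev f z ≠ f := fun h => hfz (hF1 f z (Or.inl ⟨h, hz f⟩))
  obtain ⟨k, ⟨hkz, hkgen, hkf, hk0, -⟩, -⟩ := hF5 f z
  have hk0 := hk0 hkz
  have hkf' : k ≠ f := fun h => hf (h ▸ hk0)
  have hkp : k ≠ p := fun h => hf (by rw [← hp0, ← h, hk0])
  have hkf := hkf hkf'
  have hko : k ≠ o := fun h => hfz (by rw [← ho f, ← h, hkf])
  have hof : o ≠ f := fun h => hf (by rw [← h, ho])
  have hoz : o ≠ z := fun h => hfz (by rw [← ho f, h, hz])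
  have hke : k ≠ e := fun h => hf (by
    have h1 := hkgen o hof hoz hko.symm
    rw [hz, h, hez o (h ▸ hko.symm)] at h1
    exact h1.symm)
  have hka : ev k (ev f z) = ev f z := by
    by_cases h : ev f z = k
    · rw [h, hF2]
    · rw [hkgen _ haf hf h, hz]
  obtain ⟨v, ⟨hvz, hvgen, hvk, hvp, hv⟩, -⟩ := hF5 k p
  have hv0 : ev v z = ev f z := by
    rw [hvgen z hkz.symm hpz.symm hvz.symm, hp0, hka]
  have hvk' : v ≠ k := fun h => hf (by rw [← hv0, h, hk0])
  have hve : v ≠ e := fun h => hf (by rw [← hv0, h, hee])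
  have hpo : p ≠ o := fun h => hf (by rw [← hp0, h, ho])
  have hvp' : v ≠ p := fun h => hf (by
    rw [← hpconst k hkf' hke hkp, ← h, hvk hvk'])
  have hvf : v = f := by
    by_contra h
    have h1 := hpconst v h hve hvp'
    have h2 := hv ⟨hvp'.symm, hvk'.symm, hpo, hko⟩
    rw [h1, hka] at h2
    exact hf (h2.elim id id)
  subst hvf
  exact ⟨hpe', hvp'.symm, hp0, hvp hvp', k, hkp, hke, hkf', hvk hvk'⟩

theorem apply_rigid {M : Type*} {ev : M → M → M} {z o : M}
    (hF1 : FlowF1 M ev) (hF2 : FlowF2 M ev) (hz : IsRigid M ev z) (ho : IsIdentity M ev o)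
    (hF5 : FlowF5 M ev z o) (f : M) : ev f z = z := by
  by_contra hf
  obtain ⟨e, he, hez⟩ := exists_vanishing_off_self hz hF5
  obtain ⟨p, hp, -⟩ := hF5 f e
  obtain ⟨hpe, hpf, hp0, -, k, hkp, hke, hkf, hk⟩ :=
    zeros_of_apply_rigid_ne hF1 hF2 hz ho hF5 he hez hf hp
  have hpz : ev p z ≠ z := hp0 ▸ hf
  obtain ⟨t, ht, -⟩ := hF5 p e
  obtain ⟨hte, htp, -, hpt, -⟩ :=
    zeros_of_apply_rigid_ne hF1 hF2 hz ho hF5 he hez hpz ht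
  by_cases htf : t = f
  · have h := ht.2.1 k hkp hke (htf ▸ hkf)
    rw [htf, hk, hez k hke] at h
    exact hpz h.symm
  · have h := hp.2.1 t htf hte htp
    rw [hpt, hez t hte] at h
    exact hf h.symm

theorem stmt19 {M : Type*} (ev : M → M → M) (z o : M)
    (hF1 : FlowF1 M ev) (hF2 : FlowF2 M ev)
    (hz : IsRigid M ev z) (ho : IsIdentity M ev o)
    (hF5 : FlowF5 M ev z o)
    (s : M) (hs : ImplementsF6 M ev z s) :
    ∀ f : M, ev s f = f ↔ (f = s ∨ f = z) := by
  intro f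
  constructor
  · intro hf
    by_contra! h
    have h1 := (hs.2 f h.1 h.2).1 (hf.symm ▸ h.2)
    rw [hf] at h1
    exact h.2 ((hF2 f).symm.trans h1.1)
  · rintro (rfl | rfl)
    · exact hF2 f
    · exact apply_rigid hF1 hF2 hz ho hF5 s
end
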